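/- Let η be the Haar probability measure on the compact group SU(2) of 2×2 special unitary complex matrices. Then the pushforward of η under the map k ↦ |k_{11}|² (the squared modulus of the top-left entry of k) is the uniform probability measure on [0, 1], i.e., Lebesgue measure restricted to [0, 1]. -/

import Mathlib

open MeasureTheory

/-- We endow `SU(2)` with its Borel σ-algebra. -/
noncomputable instance : MeasurableSpace (Matrix.specialUnitaryGroup (Fin 2) ℂ) :=
  borel _


instance su2BorelSpace : BorelSpace (Matrix.specialUnitaryGroup (Fin 2) ℂ) := ⟨rfl⟩

instance su2SecondCountable :
    SecondCountableTopology (Matrix.specialUnitaryGroup (Fin 2) ℂ) := by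
  have : SecondCountableTopology (Matrix (Fin 2) (Fin 2) ℂ) :=
    inferInstanceAs (SecondCountableTopology (Fin 2 → Fin 2 → ℂ))
  exact TopologicalSpace.Subtype.secondCountableTopology _

lemma radial_lintegral (b : ℝ) (hb : 0 < b) (a : ℝ) (ha : 0 ≤ a) :
    ∫⁻ r in Set.Ioi a, ENNReal.ofReal (r * Real.exp (-b * r ^ 2)) =
      ENNReal.ofReal (Real.exp (-b * a ^ 2) / (2 * b)) := by
  have hd : ∀ x ∈ Set.Ici a, HasDerivAt (fun r : ℝ => -(Real.exp (-b * r ^ 2) / (2 * b)))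
      (x * Real.exp (-b * x ^ 2)) x := by
    intro x _
    have h1 : HasDerivAt (fun r : ℝ => -b * r ^ 2) (-b * (2 * x)) x := by
      simpa using (hasDerivAt_pow 2 x).const_mul (-b)
    refine (h1.exp.div_const (2 * b)).neg.congr_deriv ?_
    field_simp
  have hp : ∀ x ∈ Set.Ioi a, 0 ≤ x * Real.exp (-b * x ^ 2) := by
    intro x hx
    have : 0 < x := lt_of_le_of_lt ha hx
    positivity
  have ht : Filter.Tendsto (fun r : ℝ => -(Real.exp (-b * r ^ 2) / (2 * b))) Filter.atTop
      (nhds 0) := by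
    have h1 : Filter.Tendsto (fun r : ℝ => -b * r ^ 2) Filter.atTop Filter.atBot :=
      (Filter.tendsto_pow_atTop two_ne_zero).const_mul_atTop_of_neg (by linarith)
    have := ((Real.tendsto_exp_atBot.comp h1).div_const (2 * b)).neg
    simpa using this
  have hi := integrableOn_Ioi_deriv_of_nonneg' hd hp ht
  rw [← ofReal_integral_eq_lintegral_ofReal hi
    ((ae_restrict_iff' measurableSet_Ioi).2 (Filter.Eventually.of_forall hp)),
    integral_Ioi_of_hasDerivAt_of_nonneg' hd hp ht]
  simp

lemma complex_gauss_tail (b : ℝ) (hb : 0 < b) (s : ℝ) (hs : 0 ≤ s) :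
    ∫⁻ z : ℂ, {z : ℂ | s < Complex.normSq z}.indicator
      (fun z => ENNReal.ofReal (Real.exp (-b * Complex.normSq z))) z =
      ENNReal.ofReal (Real.pi / b * Real.exp (-b * s)) := by
  rw [← Complex.lintegral_comp_polarCoord_symm, polarCoord_target]
  have hN : ∀ p : ℝ × ℝ, Complex.normSq (Complex.polarCoord.symm p) = p.1 ^ 2 := by
    intro p
    rw [Complex.normSq_eq_norm_sq, Complex.norm_polarCoord_symm, sq_abs]
  have : ∀ p ∈ Set.Ioi (0:ℝ) ×ˢ Set.Ioo (-Real.pi) Real.pi,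
      ENNReal.ofReal p.1 • {z : ℂ | s < Complex.normSq z}.indicator
      (fun z => ENNReal.ofReal (Real.exp (-b * Complex.normSq z))) (Complex.polarCoord.symm p)
      = (Set.Ioi (√s)).indicator (fun r => ENNReal.ofReal (r * Real.exp (-b * r ^ 2))) p.1
        * (fun _ : ℝ => (1 : ENNReal)) p.2 := by
    intro p hp
    have hp0 : 0 < p.1 := hp.1
    by_cases h : √s < p.1
    · have h2 : s < p.1 ^ 2 := (Real.sqrt_lt' hp0).1 h
      rw [Set.indicator_of_mem (by rw [Set.mem_ofPred_eq, hN]; exact h2),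
        Set.indicator_of_mem (by exact h), hN, ENNReal.ofReal_mul hp0.le, mul_one, smul_eq_mul]
    · have h2 : ¬ s < p.1 ^ 2 := fun h' => h ((Real.sqrt_lt' hp0).2 h')
      rw [Set.indicator_of_notMem (by rw [Set.mem_ofPred_eq, hN]; exact h2),
        Set.indicator_of_notMem (by exact h), zero_mul, smul_zero]
  rw [setLIntegral_congr_fun (measurableSet_Ioi.prod measurableSet_Ioo) this,
    Measure.volume_eq_prod, ← Measure.prod_restrict, 
    lintegral_prod_mul (f := (Set.Ioi (√s)).indicator
      (fun r => ENNReal.ofReal (r * Real.exp (-b * r ^ 2)))) (g := fun _ : ℝ => (1 : ENNReal)),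
    lintegral_one,
    lintegral_indicator measurableSet_Ioi, Measure.restrict_restrict measurableSet_Ioi]
  · have h3 : Set.Ioi (√s) ∩ Set.Ioi 0 = Set.Ioi (√s) := by
      rw [Set.Ioi_inter_Ioi, max_eq_left (Real.sqrt_nonneg s)]
    rw [h3, radial_lintegral b hb _ (Real.sqrt_nonneg s), Real.sq_sqrt hs]
    simp only [Measure.restrict_apply_univ, Real.volume_Ioo]
    rw [← ENNReal.ofReal_mul (by positivity)]
    congr 1
    field_simp
    ring
  · exact ((Measurable.indicator (by fun_prop) measurableSet_Ioi)).aemeasurable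
  · fun_prop

lemma complex_gauss_total (b : ℝ) (hb : 0 < b) :
    ∫⁻ z : ℂ, ENNReal.ofReal (Real.exp (-b * Complex.normSq z)) =
      ENNReal.ofReal (Real.pi / b) := by
  have h := complex_gauss_tail b hb 0 le_rfl
  rw [mul_zero, Real.exp_zero, mul_one] at h
  rw [← h]
  refine lintegral_congr_ae ?_
  have : ∀ᵐ z : ℂ, z ≠ 0 := by
    rw [ae_iff]; simp
  filter_upwards [this] with z hz
  rw [Set.indicator_of_mem]
  exact Complex.normSq_pos.2 hz

/-- squared norm on `ℂ²` -/
noncomputable def sqN (x : Fin 2 → ℂ) : ℝ := Complex.normSq (x 0) + Complex.normSq (x 1)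

lemma sqN_continuous : Continuous sqN := by
  unfold sqN
  exact (Complex.continuous_normSq.comp (continuous_apply 0)).add
    (Complex.continuous_normSq.comp (continuous_apply 1))

lemma gauss_total :
    ∫⁻ x : Fin 2 → ℂ, ENNReal.ofReal (Real.exp (-sqN x)) = ENNReal.ofReal (Real.pi ^ 2) := by
  have hm : Measurable (fun z : ℂ => ENNReal.ofReal (Real.exp (-1 * Complex.normSq z))) :=
    (Real.continuous_exp.comp
      (Complex.continuous_normSq.const_mul (-1))).measurable.ennreal_ofReal
  have hρ : Measurable (fun x : Fin 2 → ℂ => ENNReal.ofReal (Real.exp (-sqN x))) :=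
    (Real.continuous_exp.comp sqN_continuous.neg).measurable.ennreal_ofReal
  rw [← (volume_preserving_finTwoArrow ℂ).symm.lintegral_comp hρ]
  have : ∀ p : ℂ × ℂ, ENNReal.ofReal (Real.exp (-sqN (MeasurableEquiv.finTwoArrow.symm p)))
      = ENNReal.ofReal (Real.exp (-1 * Complex.normSq p.1)) *
        ENNReal.ofReal (Real.exp (-1 * Complex.normSq p.2)) := by
    intro p
    rw [← ENNReal.ofReal_mul (Real.exp_pos _).le, ← Real.exp_add]
    congr 2
    simp [sqN, MeasurableEquiv.finTwoArrow, MeasurableEquiv.piFinTwo]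
    ring
  simp_rw [this]
  rw [Measure.volume_eq_prod, lintegral_prod_mul hm.aemeasurable hm.aemeasurable,
    complex_gauss_total 1 one_pos, ← ENNReal.ofReal_mul (by positivity)]
  congr 1
  ring

lemma gauss_cap (t : ℝ) (h0 : 0 ≤ t) (h1 : t < 1) :
    ∫⁻ x : Fin 2 → ℂ, {x | t * sqN x < Complex.normSq (x 0)}.indicator
      (fun x => ENNReal.ofReal (Real.exp (-sqN x))) x
      = ENNReal.ofReal (Real.pi ^ 2 * (1 - t)) := by
  have hs : 0 < 1 - t := by linarith
  have hm : Measurable ({x : Fin 2 → ℂ | t * sqN x < Complex.normSq (x 0)}.indicator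
      (fun x => ENNReal.ofReal (Real.exp (-sqN x)))) := by
    refine Measurable.indicator
      (Real.continuous_exp.comp sqN_continuous.neg).measurable.ennreal_ofReal ?_
    exact (isOpen_lt (sqN_continuous.const_mul t)
      (Complex.continuous_normSq.comp (continuous_apply 0))).measurableSet
  have hmp := (volume_preserving_finTwoArrow ℂ).symm
  rw [← hmp.lintegral_comp hm, Measure.volume_eq_prod,
    lintegral_prod_symm (fun a : ℂ × ℂ =>
      {x : Fin 2 → ℂ | t * sqN x < Complex.normSq (x 0)}.indicator
      (fun x => ENNReal.ofReal (Real.exp (-sqN x))) (MeasurableEquiv.finTwoArrow.symm a)) (hm.comp hmp.measurable).aemeasurable]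
  have : ∀ w z : ℂ, {x : Fin 2 → ℂ | t * sqN x < Complex.normSq (x 0)}.indicator
      (fun x => ENNReal.ofReal (Real.exp (-sqN x))) (MeasurableEquiv.finTwoArrow.symm (z, w))
      = ENNReal.ofReal (Real.exp (-Complex.normSq w)) *
        {z : ℂ | t / (1 - t) * Complex.normSq w < Complex.normSq z}.indicator
      (fun z => ENNReal.ofReal (Real.exp (-1 * Complex.normSq z))) z := by
    intro w z
    have hN : sqN (MeasurableEquiv.finTwoArrow.symm (z, w))
        = Complex.normSq z + Complex.normSq w := by
      simp [sqN, MeasurableEquiv.finTwoArrow, MeasurableEquiv.piFinTwo]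
    have hz : (MeasurableEquiv.finTwoArrow.symm (z, w) : Fin 2 → ℂ) 0 = z := by
      simp [MeasurableEquiv.finTwoArrow, MeasurableEquiv.piFinTwo]
    have hiff : t * (Complex.normSq z + Complex.normSq w) < Complex.normSq z ↔
        t / (1 - t) * Complex.normSq w < Complex.normSq z := by
      rw [div_mul_eq_mul_div, div_lt_iff₀ hs]
      constructor <;> intro h <;> linarith
    simp only [Set.indicator, Set.mem_ofPred_eq, hN, hz, hiff]
    split_ifs
    · rw [← ENNReal.ofReal_mul (Real.exp_pos _).le, ← Real.exp_add]
      congr 2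
      ring
    · simp
  simp_rw [this]
  have h2 : ∀ w : ℂ, ∫⁻ z : ℂ, ENNReal.ofReal (Real.exp (-Complex.normSq w)) *
        {z : ℂ | t / (1 - t) * Complex.normSq w < Complex.normSq z}.indicator
      (fun z => ENNReal.ofReal (Real.exp (-1 * Complex.normSq z))) z =
      ENNReal.ofReal Real.pi *
        ENNReal.ofReal (Real.exp (-(1 / (1 - t)) * Complex.normSq w)) := by
    intro w
    rw [lintegral_const_mul', complex_gauss_tail 1 one_pos _
      (mul_nonneg (div_nonneg h0 hs.le) (Complex.normSq_nonneg w)),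
      ← ENNReal.ofReal_mul (Real.exp_pos _).le, ← ENNReal.ofReal_mul Real.pi_pos.le]
    · congr 1
      rw [div_one, mul_left_comm, ← Real.exp_add]
      congr 2
      field_simp
      ring
    · exact ENNReal.ofReal_ne_top
  simp_rw [h2]
  rw [lintegral_const_mul' _ _ ENNReal.ofReal_ne_top, complex_gauss_total _ (by positivity),
    ← ENNReal.ofReal_mul Real.pi_pos.le]
  congr 1
  field_simp

lemma su2_measurePreserving (k : Matrix.specialUnitaryGroup (Fin 2) ℂ) :
    MeasurePreserving (fun x : Fin 2 → ℂ => (k : Matrix (Fin 2) (Fin 2) ℂ).mulVec x) := by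
  have hdet : (k : Matrix (Fin 2) (Fin 2) ℂ).det = 1 :=
    (Matrix.mem_specialUnitaryGroup_iff.1 k.2).2
  set f : (Fin 2 → ℂ) →ₗ[ℝ] (Fin 2 → ℂ) :=
    LinearMap.restrictScalars ℝ (Matrix.toLin' (k : Matrix (Fin 2) (Fin 2) ℂ)) with hf
  have hd : LinearMap.det f = 1 := by
    rw [hf, LinearMap.det_restrictScalars, LinearMap.det_toLin', hdet, map_one]
  have := Measure.map_linearMap_addHaar_eq_smul_addHaar
    (volume : Measure (Fin 2 → ℂ)) (f := f) (by rw [hd]; exact one_ne_zero)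
  rw [hd] at this
  refine ⟨f.continuous_of_finiteDimensional.measurable, ?_⟩
  have h2 : (fun x : Fin 2 → ℂ => (k : Matrix (Fin 2) (Fin 2) ℂ).mulVec x) = f := by
    ext x; simp [hf]
  rw [h2, this]
  simp

lemma su2_sqN (k : Matrix.specialUnitaryGroup (Fin 2) ℂ) (x : Fin 2 → ℂ) :
    sqN ((k : Matrix (Fin 2) (Fin 2) ℂ).mulVec x) = sqN x := by
  have hN : ∀ y : Fin 2 → ℂ, ((sqN y : ℝ) : ℂ) = star y ⬝ᵥ y := by
    intro y
    simp [sqN, dotProduct, Fin.sum_univ_two, Complex.normSq_eq_conj_mul_self]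
  have hu : star (k : Matrix (Fin 2) (Fin 2) ℂ) * k = 1 :=
    Matrix.mem_unitaryGroup_iff'.1 (Matrix.mem_specialUnitaryGroup_iff.1 k.2).1
  apply Complex.ofReal_injective
  rw [hN, hN, Matrix.star_mulVec, ← Matrix.dotProduct_mulVec, Matrix.mulVec_mulVec,
    ← Matrix.star_eq_conjTranspose, hu, Matrix.one_mulVec]

lemma sqN_pos (x : Fin 2 → ℂ) (hx : x ≠ 0) : 0 < sqN x := by
  have a0 := Complex.normSq_nonneg (x 0)
  have a1 := Complex.normSq_nonneg (x 1)
  unfold sqN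
  by_contra h
  apply hx
  ext i
  fin_cases i
  · exact Complex.normSq_eq_zero.1 (show Complex.normSq (x 0) = 0 by linarith)
  · exact Complex.normSq_eq_zero.1 (show Complex.normSq (x 1) = 0 by linarith)

lemma su2_exists (x : Fin 2 → ℂ) (hx : x ≠ 0) :
    ∃ g : Matrix.specialUnitaryGroup (Fin 2) ℂ, ∀ k : Matrix.specialUnitaryGroup (Fin 2) ℂ,
      Complex.normSq ((star (k : Matrix (Fin 2) (Fin 2) ℂ)).mulVec x 0) =
        sqN x * Complex.normSq (((g * k : Matrix.specialUnitaryGroup (Fin 2) ℂ) :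
          Matrix (Fin 2) (Fin 2) ℂ) 0 0) := by
  have hpos := sqN_pos x hx
  set c : ℝ := 1 / √(sqN x) with hc
  have hcc : c * c * sqN x = 1 := by
    rw [hc, div_mul_div_comm, Real.mul_self_sqrt hpos.le]
    field_simp
  have hcC : (c : ℂ) * c * (star (x 0) * x 0 + star (x 1) * x 1) = 1 := by
    have h := congrArg (fun r : ℝ => (r : ℂ)) hcc
    simpa [sqN, Complex.normSq_eq_conj_mul_self] using h
  have hmem : !![(c : ℂ) * star (x 0), c * star (x 1); -(c * x 1), c * x 0] ∈
      Matrix.specialUnitaryGroup (Fin 2) ℂ := by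
    rw [Matrix.mem_specialUnitaryGroup_iff]
    constructor
    · rw [Matrix.mem_unitaryGroup_iff]
      ext i j
      fin_cases i <;> fin_cases j <;>
        simp [Matrix.mul_apply, Fin.sum_univ_two, Matrix.star_apply] <;>
        simp only [Complex.star_def] at hcC <;> first | ring1 | linear_combination hcC
    · rw [Matrix.det_fin_two_of]
      linear_combination hcC
  refine ⟨⟨_, hmem⟩, fun k => ?_⟩
  have h1 : (star (k : Matrix (Fin 2) (Fin 2) ℂ)).mulVec x 0 =
      star (star (x 0) * (k : Matrix (Fin 2) (Fin 2) ℂ) 0 0 +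
        star (x 1) * (k : Matrix (Fin 2) (Fin 2) ℂ) 1 0) := by
    simp [Matrix.mulVec, dotProduct, Fin.sum_univ_two, Matrix.star_apply]
    ring
  have h2 : (((⟨_, hmem⟩ * k : Matrix.specialUnitaryGroup (Fin 2) ℂ) :
          Matrix (Fin 2) (Fin 2) ℂ) 0 0) = c * (star (x 0) * (k : Matrix (Fin 2) (Fin 2) ℂ) 0 0 +
        star (x 1) * (k : Matrix (Fin 2) (Fin 2) ℂ) 1 0) := by
    simp [Matrix.mul_apply, Fin.sum_univ_two]
    ring
  rw [h1, h2, Complex.star_def, Complex.normSq_conj, Complex.normSq_mul, Complex.normSq_ofReal,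
    ← mul_assoc, mul_comm (sqN x), hcc, one_mul]

lemma entry_continuous (i j : Fin 2) : Continuous
    (fun k : Matrix.specialUnitaryGroup (Fin 2) ℂ => (k : Matrix (Fin 2) (Fin 2) ℂ) i j) :=
  continuous_subtype_val.matrix_elem i j

lemma key (η : Measure (Matrix.specialUnitaryGroup (Fin 2) ℂ)) [IsProbabilityMeasure η]
    (hinv : ∀ g : Matrix.specialUnitaryGroup (Fin 2) ℂ,
      η.map (fun k => g * k) = η) (t : ℝ) (h0 : 0 ≤ t) (h1 : t < 1) :
    η {k | t < Complex.normSq ((k : Matrix (Fin 2) (Fin 2) ℂ) 0 0)} = ENNReal.ofReal (1 - t) := by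
  set F := η {k | t < Complex.normSq ((k : Matrix (Fin 2) (Fin 2) ℂ) 0 0)} with hF
  have hρ : Measurable (fun x : Fin 2 → ℂ => ENNReal.ofReal (Real.exp (-sqN x))) :=
    (Real.continuous_exp.comp sqN_continuous.neg).measurable.ennreal_ofReal
  let S : Set (Matrix.specialUnitaryGroup (Fin 2) ℂ × (Fin 2 → ℂ)) :=
    {p | t * sqN p.2 < Complex.normSq ((star (p.1 : Matrix (Fin 2) (Fin 2) ℂ)).mulVec p.2 0)}
  have hS : IsOpen S := by
    refine isOpen_lt ((sqN_continuous.comp continuous_snd).const_mul t)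
      (Complex.continuous_normSq.comp ?_)
    have e : (fun p : Matrix.specialUnitaryGroup (Fin 2) ℂ × (Fin 2 → ℂ) =>
        (star (p.1 : Matrix (Fin 2) (Fin 2) ℂ)).mulVec p.2 0) = fun p =>
        star ((p.1 : Matrix (Fin 2) (Fin 2) ℂ) 0 0) * p.2 0 +
        star ((p.1 : Matrix (Fin 2) (Fin 2) ℂ) 1 0) * p.2 1 := by
      funext p
      simp [Matrix.mulVec, dotProduct, Fin.sum_univ_two, Matrix.star_apply]
    rw [e]
    have a0 := ((entry_continuous 0 0).comp
      (continuous_fst (X := Matrix.specialUnitaryGroup (Fin 2) ℂ) (Y := Fin 2 → ℂ))).star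
    have a1 := ((entry_continuous 1 0).comp
      (continuous_fst (X := Matrix.specialUnitaryGroup (Fin 2) ℂ) (Y := Fin 2 → ℂ))).star
    exact (a0.mul ((continuous_apply 0).comp continuous_snd)).add
      (a1.mul ((continuous_apply 1).comp continuous_snd))
  let G : Matrix.specialUnitaryGroup (Fin 2) ℂ → (Fin 2 → ℂ) → ENNReal :=
    fun k x => S.indicator (fun p => ENNReal.ofReal (Real.exp (-sqN p.2))) (k, x)
  have hG : Measurable (Function.uncurry G) :=
    Measurable.indicator (hρ.comp measurable_snd) hS.measurableSet
  have hA : ∀ k, ∫⁻ x, G k x = ENNReal.ofReal (Real.pi ^ 2 * (1 - t)) := by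
    intro k
    have hm : Measurable ({x : Fin 2 → ℂ | t * sqN x < Complex.normSq (x 0)}.indicator
        (fun x => ENNReal.ofReal (Real.exp (-sqN x)))) := by
      refine Measurable.indicator hρ ?_
      exact (isOpen_lt (sqN_continuous.const_mul t)
        (Complex.continuous_normSq.comp (continuous_apply 0))).measurableSet
    rw [← gauss_cap t h0 h1, ← (su2_measurePreserving (star k)).lintegral_comp hm]
    refine lintegral_congr fun x => ?_
    have hN := su2_sqN (star k) x
    simp only [G, S, Set.indicator, Set.mem_ofPred_eq, hN]
    rfl
  have hB : ∀ᵐ x : Fin 2 → ℂ, ∫⁻ k, G k x ∂η = F * ENNReal.ofReal (Real.exp (-sqN x)) := by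
    have : ∀ᵐ x : Fin 2 → ℂ, x ≠ 0 := by
      rw [ae_iff]; simp
    filter_upwards [this] with x hx
    obtain ⟨g, hg⟩ := su2_exists x hx
    have hpos := sqN_pos x hx
    have hT : MeasurableSet {k : Matrix.specialUnitaryGroup (Fin 2) ℂ |
        t < Complex.normSq ((k : Matrix (Fin 2) (Fin 2) ℂ) 0 0)} :=
      (isOpen_lt continuous_const
        (Complex.continuous_normSq.comp (entry_continuous 0 0))).measurableSet
    have hgm : Measurable (fun k : Matrix.specialUnitaryGroup (Fin 2) ℂ => g * k) :=
      (continuous_const.mul continuous_id).measurable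
    have e : ∀ k, G k x = ((fun k => g * k) ⁻¹' {k : Matrix.specialUnitaryGroup (Fin 2) ℂ |
        t < Complex.normSq ((k : Matrix (Fin 2) (Fin 2) ℂ) 0 0)}).indicator
          (fun _ => ENNReal.ofReal (Real.exp (-sqN x))) k := by
      intro k
      have : t * sqN x < sqN x * Complex.normSq (((g * k :
          Matrix.specialUnitaryGroup (Fin 2) ℂ) : Matrix (Fin 2) (Fin 2) ℂ) 0 0) ↔
          t < Complex.normSq (((g * k :
          Matrix.specialUnitaryGroup (Fin 2) ℂ) : Matrix (Fin 2) (Fin 2) ℂ) 0 0) := by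
        rw [mul_comm t]
        exact mul_lt_mul_iff_right₀ hpos
      simp only [G, S, Set.indicator, Set.mem_ofPred_eq, Set.mem_preimage, hg, this]
    simp_rw [e]
    rw [lintegral_indicator_const (hgm hT), ← Measure.map_apply hgm hT, hinv g, mul_comm]
  have hswap := lintegral_lintegral_swap (μ := η) (ν := (volume : Measure (Fin 2 → ℂ)))
    hG.aemeasurable
  simp_rw [hA] at hswap
  rw [lintegral_congr_ae hB, lintegral_const_mul _ hρ, gauss_total, lintegral_const,
    measure_univ, mul_one, ENNReal.ofReal_mul (by positivity), mul_comm] at hswap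
  have hp : ENNReal.ofReal (Real.pi ^ 2) ≠ 0 := by
    simp [Real.pi_pos.ne']
  exact ((ENNReal.mul_left_inj hp ENNReal.ofReal_ne_top).1 hswap).symm

lemma entry_le (k : Matrix.specialUnitaryGroup (Fin 2) ℂ) :
    Complex.normSq ((k : Matrix (Fin 2) (Fin 2) ℂ) 0 0) ≤ 1 := by
  have h := su2_sqN k ![1, 0]
  simp [sqN, Matrix.mulVec, dotProduct, Fin.sum_univ_two] at h
  have := Complex.normSq_nonneg ((k : Matrix (Fin 2) (Fin 2) ℂ) 1 0)
  linarith

/-- Archimedes for `SU(2)`: if `η` is the Haar probability measure on `SU(2)`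
(the left-invariant probability measure), then the squared modulus of
the top-left entry `|k₁₁|²` is uniformly distributed on `[0, 1]`. -/
theorem su2_entry_sq_uniform
    (η : Measure (Matrix.specialUnitaryGroup (Fin 2) ℂ)) [IsProbabilityMeasure η]
    (hinv : ∀ g : Matrix.specialUnitaryGroup (Fin 2) ℂ,
      η.map (fun k => g * k) = η) :
    η.map (fun k : Matrix.specialUnitaryGroup (Fin 2) ℂ => Complex.normSq ((k : Matrix (Fin 2) (Fin 2) ℂ) 0 0)) =
      (volume : Measure ℝ).restrict (Set.Icc 0 1) := by
  have hm : Measurable (fun k : Matrix.specialUnitaryGroup (Fin 2) ℂ =>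
      Complex.normSq ((k : Matrix (Fin 2) (Fin 2) ℂ) 0 0)) :=
    (Complex.continuous_normSq.comp (entry_continuous 0 0)).measurable
  have : IsProbabilityMeasure (η.map (fun k : Matrix.specialUnitaryGroup (Fin 2) ℂ =>
      Complex.normSq ((k : Matrix (Fin 2) (Fin 2) ℂ) 0 0))) :=
    Measure.isProbabilityMeasure_map hm.aemeasurable
  have : IsProbabilityMeasure ((volume : Measure ℝ).restrict (Set.Icc 0 1)) := ⟨by simp⟩
  refine Measure.ext_of_Iic _ _ fun t => ?_
  rw [← Set.compl_Ioi, prob_compl_eq_one_sub measurableSet_Ioi,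
    prob_compl_eq_one_sub measurableSet_Ioi, Measure.map_apply hm measurableSet_Ioi,
    Measure.restrict_apply measurableSet_Ioi]
  congr 1
  rcases lt_or_ge t 0 with h0 | h0
  · have e1 : (fun k : Matrix.specialUnitaryGroup (Fin 2) ℂ =>
        Complex.normSq ((k : Matrix (Fin 2) (Fin 2) ℂ) 0 0)) ⁻¹' Set.Ioi t = Set.univ := by
      ext k
      simpa using lt_of_lt_of_le h0 (Complex.normSq_nonneg _)
    have e2 : Set.Ioi t ∩ Set.Icc 0 1 = Set.Icc 0 1 :=
      Set.inter_eq_right.2 fun y hy => lt_of_lt_of_le h0 hy.1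
    rw [e1, e2]
    simp
  rcases lt_or_ge t 1 with h1 | h1
  · have e2 : Set.Ioi t ∩ Set.Icc 0 1 = Set.Ioc t 1 := by
      ext y
      simp only [Set.mem_inter_iff, Set.mem_Ioi, Set.mem_Icc, Set.mem_Ioc]
      constructor
      · rintro ⟨a, b, c⟩
        exact ⟨a, c⟩
      · rintro ⟨a, c⟩
        exact ⟨a, by linarith, c⟩
    rw [e2, Real.volume_Ioc]
    exact key η hinv t h0 h1
  · have e1 : (fun k : Matrix.specialUnitaryGroup (Fin 2) ℂ =>
        Complex.normSq ((k : Matrix (Fin 2) (Fin 2) ℂ) 0 0)) ⁻¹' Set.Ioi t = ∅ := by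
      ext k
      simpa using (entry_le k).trans h1
    have e2 : Set.Ioi t ∩ Set.Icc 0 1 = ∅ := by
      ext y
      simp only [Set.mem_inter_iff, Set.mem_Ioi, Set.mem_Icc, Set.mem_empty_iff_false, iff_false]
      rintro ⟨a, b, c⟩
      linarith
    rw [e1, e2]
    simp
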